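/- arXiv:2312.03287 — 2 statements merged into one kernel-verified Lean document; each statement's English description precedes it below -/
import Mathlib

section
/- For any sufficiently smooth function u on ℝ^{1+2} supported in the cone K, and any s ∈ [2,+∞), one has the conformal energy estimate [E_con(u,s)]^{1/2} ≲ [E_con(u,2)]^{1/2} + ∫_2^s τ ‖□u‖_{L²_f(H_τ)} dτ, with an implied constant independent of u and s. -/
open MeasureTheory Real Filter Topology
open scoped ENNReal NNReal

noncomputable section

/-- A spacetime point in `ℝ^{1+2}`: coordinates `(x₀, x₁, x₂)` with `t = x₀`. -/
abbrev Pt : Type := Fin 3 → ℝ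

/-- The `i`-th standard basis vector of `ℝ^{1+2}`. -/
def e3 (i : Fin 3) : Pt := Pi.single i 1

/-- Partial derivative `∂_i`. -/
def pd (i : Fin 3) (u : Pt → ℝ) : Pt → ℝ := fun p => fderiv ℝ u p (e3 i)

/-- Spatial radius `r = |x|`. -/
def rad (p : Pt) : ℝ := Real.sqrt ((p 1) ^ 2 + (p 2) ^ 2)

/-- Hyperbolic time `s = √(t² − |x|²)`. -/
def sVar (p : Pt) : ℝ := Real.sqrt ((p 0) ^ 2 - (p 1) ^ 2 - (p 2) ^ 2)

/-- The cone `K = {(t,x) : t ≥ 2, |x| < t − 1}`. -/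
def Cone : Set Pt := {p | 2 ≤ p 0 ∧ rad p < p 0 - 1}

/-- Lorentz boost `L_a = x_a ∂_t + t ∂_a`, `a ∈ {1,2}`. -/
def Lb (a : Fin 2) (u : Pt → ℝ) : Pt → ℝ :=
  fun p => p a.succ * pd 0 u p + p 0 * pd a.succ u p

/-- Semi-hyperboloidal derivative `∂̲_a = (x_a/t)∂_t + ∂_a`. -/
def dund (a : Fin 2) (u : Pt → ℝ) : Pt → ℝ :=
  fun p => (p a.succ / p 0) * pd 0 u p + pd a.succ u p

/-- The ordered family `{Γ_k} = {∂₀, ∂₁, ∂₂, L₁, L₂}`. -/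
def Gam : Fin 5 → (Pt → ℝ) → (Pt → ℝ) := ![pd 0, pd 1, pd 2, Lb 0, Lb 1]

/-- `Γ^I = Π_k Γ_k^{i_k}` for a multi-index `I ∈ ℕ⁵`. -/
def GamI (I : Fin 5 → ℕ) : (Pt → ℝ) → (Pt → ℝ) :=
  (Gam 0)^[I 0] ∘ (Gam 1)^[I 1] ∘ (Gam 2)^[I 2] ∘ (Gam 3)^[I 3] ∘ (Gam 4)^[I 4]

/-- Length `|I|` of a multi-index. -/
def mlen (I : Fin 5 → ℕ) : ℕ := ∑ k, I k

/-- The (finite) set of multi-indices `I ∈ ℕ⁵` with `|I| ≤ n`. -/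
def midxLe (n : ℕ) : Finset (Fin 5 → ℕ) :=
  (Fintype.piFinset fun _ => Finset.range (n + 1)).filter fun I => mlen I ≤ n

/-- The (finite) set of multi-indices `I ∈ ℕ⁵` with `|I| = 1`. -/
def midxEq1 : Finset (Fin 5 → ℕ) :=
  (Fintype.piFinset fun _ => Finset.range 2).filter fun I => mlen I = 1

/-- `|∂u| = (Σ_α |∂_α u|²)^{1/2}`. -/
def pdNorm (u : Pt → ℝ) (p : Pt) : ℝ := Real.sqrt (∑ α, (pd α u p) ^ 2)

/-- The wave operator `□ = −∂_t² + ∂₁² + ∂₂²`. -/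
def box (u : Pt → ℝ) : Pt → ℝ :=
  fun p => - pd 0 (pd 0 u) p + pd 1 (pd 1 u) p + pd 2 (pd 2 u) p

/-- The null condition for constants `P^{γαβ}`. -/
def NullCond (P : Fin 3 → Fin 3 → Fin 3 → ℝ) : Prop :=
  ∀ ξ : Fin 3 → ℝ, ξ 0 ^ 2 = ξ 1 ^ 2 + ξ 2 ^ 2 →
    ∑ γ, ∑ α, ∑ β, P γ α β * ξ γ * ξ α * ξ β = 0

/-- The symmetry condition `P^{γαβ} = P^{γβα}`. -/
def SymmCond (P : Fin 3 → Fin 3 → Fin 3 → ℝ) : Prop := ∀ γ α β, P γ α β = P γ β α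

/-- Null form `N(w,z) = P^{γαβ} ∂_γ w ∂_α∂_β z`. -/
def Nform (P : Fin 3 → Fin 3 → Fin 3 → ℝ) (w z : Pt → ℝ) : Pt → ℝ :=
  fun p => ∑ γ, ∑ α, ∑ β, P γ α β * pd γ w p * pd α (pd β z) p

/-- The point of the hyperboloid `H_s` above `x ∈ ℝ²`. -/
def hypPt (s : ℝ) (x : Fin 2 → ℝ) : Pt :=
  ![Real.sqrt (s ^ 2 + (x 0) ^ 2 + (x 1) ^ 2), x 0, x 1]

/-- `‖u‖_{L²_f(H_s)}`. -/
def L2H (u : Pt → ℝ) (s : ℝ) : ℝ :=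
  (∫ x : Fin 2 → ℝ, (u (hypPt s x)) ^ 2) ^ (1 / 2 : ℝ)

/-- The hyperboloidal energy `E_m(u,s)`. -/
def Em (m : ℝ) (u : Pt → ℝ) (s : ℝ) : ℝ :=
  ∫ x : Fin 2 → ℝ,
    (((s / hypPt s x 0) * pd 0 u (hypPt s x)) ^ 2
      + ∑ a : Fin 2, (dund a u (hypPt s x)) ^ 2
      + m ^ 2 * (u (hypPt s x)) ^ 2)

/-- `K₀ = s∂_s + 2x^a∂̲_a`, where `s∂_s = (s²/t)∂_t`. -/
def K0op (u : Pt → ℝ) : Pt → ℝ :=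
  fun p => (sVar p) ^ 2 / p 0 * pd 0 u p + 2 * ∑ a : Fin 2, p a.succ * dund a u p

/-- The conformal energy `E_con(u,s)`. -/
def Econ (u : Pt → ℝ) (s : ℝ) : ℝ :=
  ∫ x : Fin 2 → ℝ,
    ((K0op u (hypPt s x) + u (hypPt s x)) ^ 2
      + ∑ a : Fin 2, (s * dund a u (hypPt s x)) ^ 2)


lemma contDiff_pd {u : Pt → ℝ} (hu : ContDiff ℝ (⊤ : ℕ∞) u) (i : Fin 3) :
    ContDiff ℝ (⊤ : ℕ∞) (pd i u) :=
  (hu.fderiv_right (m := (⊤ : ℕ∞)) (by simp)).clm_apply contDiff_const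

lemma pd_comm {u : Pt → ℝ} (hu : ContDiff ℝ (⊤ : ℕ∞) u) (i j : Fin 3) (p : Pt) :
    pd i (pd j u) p = pd j (pd i u) p := by
  have hd : DifferentiableAt ℝ (fderiv ℝ u) p :=
    ((hu.fderiv_right (m := (⊤ : ℕ∞)) (by simp)).differentiable (by simp)).differentiableAt
  have hs : IsSymmSndFDerivAt ℝ u p :=
    (contDiff_infty.1 hu 2).contDiffAt.isSymmSndFDerivAt (by simp)
  have key : ∀ i j : Fin 3, pd i (pd j u) p = fderiv ℝ (fderiv ℝ u) p (e3 i) (e3 j) := by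
    intro i j
    have h : HasFDerivAt (pd j u) _ p :=
      (ContinuousLinearMap.apply ℝ ℝ (e3 j)).hasFDerivAt.comp p hd.hasFDerivAt
    change fderiv ℝ (pd j u) p (e3 i) = _
    rw [h.fderiv]
    rfl
  rw [key, key, hs.eq]

lemma pd_congr {f g : Pt → ℝ} {p : Pt} (h : f =ᶠ[𝓝 p] g) (i : Fin 3) :
    pd i f =ᶠ[𝓝 p] pd i g := by
  filter_upwards [h.fderiv (𝕜 := ℝ)] with q hq
  simp [pd, hq]

lemma pd_zero (i : Fin 3) : pd i (fun _ => 0) = fun _ => 0 := by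
  ext p; simp [pd]

lemma pd_const (i : Fin 3) (c : ℝ) (p : Pt) : pd i (fun _ => c) p = 0 := by
  simp [pd]

lemma pd_coord (i j : Fin 3) (p : Pt) : pd i (fun q => q j) p = if j = i then 1 else 0 := by
  have : HasFDerivAt (fun q : Pt => q j) (ContinuousLinearMap.proj j) p :=
    (ContinuousLinearMap.proj (R := ℝ) (φ := fun _ : Fin 3 => ℝ) j).hasFDerivAt
  simp [pd, this.fderiv, e3, Pi.single_apply]

lemma pd_add {f g : Pt → ℝ} {p : Pt} (i : Fin 3) (hf : DifferentiableAt ℝ f p)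
    (hg : DifferentiableAt ℝ g p) :
    pd i (fun q => f q + g q) p = pd i f p + pd i g p := by
  simp [pd, fderiv_fun_add hf hg]

lemma pd_sub {f g : Pt → ℝ} {p : Pt} (i : Fin 3) (hf : DifferentiableAt ℝ f p)
    (hg : DifferentiableAt ℝ g p) :
    pd i (fun q => f q - g q) p = pd i f p - pd i g p := by
  simp [pd, fderiv_fun_sub hf hg]

lemma pd_mul {f g : Pt → ℝ} {p : Pt} (i : Fin 3) (hf : DifferentiableAt ℝ f p)
    (hg : DifferentiableAt ℝ g p) :
    pd i (fun q => f q * g q) p = f p * pd i g p + pd i f p * g p := by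
  simp [pd, fderiv_fun_mul hf hg, mul_comm]

lemma pd_pow {f : Pt → ℝ} {p : Pt} (i : Fin 3) (hf : DifferentiableAt ℝ f p) :
    pd i (fun q => f q ^ 2) p = 2 * f p * pd i f p := by
  simp only [sq]
  rw [pd_mul i hf hf]; ring

lemma hasDerivAt_line {f : Pt → ℝ} {p : Pt} (i : Fin 3) (hf : DifferentiableAt ℝ f p) :
    HasDerivAt (fun t : ℝ => f (p + t • e3 i)) (pd i f p) 0 :=
  hf.hasFDerivAt.hasLineDerivAt (e3 i)

/-- The time function `√(s² + |x|²)` in the coordinates `(s, x)`. -/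
def hypTime (q : Pt) : ℝ := Real.sqrt (q 0 ^ 2 + q 1 ^ 2 + q 2 ^ 2)

/-- The change of coordinates `(s, x) ↦ (t, x)` adapted to the hyperboloidal foliation. -/
def hypMap (q : Pt) : Pt := ![hypTime q, q 1, q 2]

/-- The point with hyperboloidal coordinates `(s, x)`. -/
def slicePt (s : ℝ) (x : Fin 2 → ℝ) : Pt := ![s, x 0, x 1]

lemma hypPt_eq (s : ℝ) (x : Fin 2 → ℝ) : hypPt s x = hypMap (slicePt s x) := by
  simp [hypPt, hypMap, slicePt, hypTime]

lemma continuous_hypTime : Continuous hypTime := by unfold hypTime; fun_prop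

lemma continuous_hypMap : Continuous hypMap := by
  refine continuous_pi fun i => ?_
  fin_cases i
  · exact continuous_hypTime
  · exact continuous_apply (1 : Fin 3)
  · exact continuous_apply (2 : Fin 3)

lemma hypTime_sq (q : Pt) : hypTime q ^ 2 = q 0 ^ 2 + q 1 ^ 2 + q 2 ^ 2 :=
  Real.sq_sqrt (by positivity)

lemma hypTime_pos {q : Pt} (hq : 0 < q 0) : 0 < hypTime q :=
  Real.sqrt_pos.2 (by positivity)

lemma contDiffAt_hypTime {q : Pt} (hq : 0 < hypTime q) :
    ContDiffAt ℝ (⊤ : ℕ∞) hypTime q := by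
  have : q 0 ^ 2 + q 1 ^ 2 + q 2 ^ 2 ≠ 0 := (Real.sqrt_pos.1 hq).ne'
  unfold hypTime
  exact ContDiffAt.sqrt (by fun_prop) this

lemma contDiffAt_hypMap {q : Pt} (hq : 0 < hypTime q) :
    ContDiffAt ℝ (⊤ : ℕ∞) hypMap q := by
  refine contDiffAt_pi.2 fun i => ?_
  fin_cases i
  · exact contDiffAt_hypTime hq
  · exact contDiffAt_apply ℝ ℝ (1 : Fin 3) q
  · exact contDiffAt_apply ℝ ℝ (2 : Fin 3) q

lemma pd_hypTime {q : Pt} (hq : 0 < hypTime q) (i : Fin 3) :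
    pd i hypTime q = q i / hypTime q := by
  have hd : DifferentiableAt ℝ hypTime q := (contDiffAt_hypTime hq).differentiableAt (by simp)
  have h1 := pd_pow i hd
  have h2 : pd i (fun q => hypTime q ^ 2) q = 2 * q i := by
    simp only [hypTime_sq]
    simp (disch := fun_prop) only [pd_add, pd_pow, pd_coord]
    fin_cases i <;> simp
  rw [h2] at h1
  field_simp
  linarith

lemma pd_inv_hypTime {q : Pt} (hq : 0 < hypTime q) (i : Fin 3) :
    pd i (fun q => (hypTime q)⁻¹) q = - q i / hypTime q ^ 3 := by
  have hd : DifferentiableAt ℝ hypTime q := (contDiffAt_hypTime hq).differentiableAt (by simp)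
  have := (hasDerivAt_inv hq.ne').comp_hasFDerivAt q hd.hasFDerivAt
  have h2 : pd i (fun q => (hypTime q)⁻¹) q = -(hypTime q ^ 2)⁻¹ * pd i hypTime q := by
    have h3 := this.fderiv
    simp only [Function.comp_def] at h3
    simp [pd, h3]
  rw [h2, pd_hypTime hq]
  field_simp

lemma pd_comp_hypMap {g : Pt → ℝ} {q : Pt} (hq : 0 < hypTime q)
    (hg : DifferentiableAt ℝ g (hypMap q)) (i : Fin 3) :
    pd i (fun q => g (hypMap q)) q
      = q i * (hypTime q)⁻¹ * pd 0 g (hypMap q) + if i = 0 then 0 else pd i g (hypMap q) := by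
  have hM : DifferentiableAt ℝ hypMap q := (contDiffAt_hypMap hq).differentiableAt (by simp)
  have hc := hg.hasFDerivAt.comp q hM.hasFDerivAt
  have hv : fderiv ℝ hypMap q (e3 i)
      = (q i * (hypTime q)⁻¹) • e3 0 + if i = 0 then 0 else e3 i := by
    ext j
    have hj : fderiv ℝ hypMap q (e3 i) j = pd i (fun q => hypMap q j) q := by
      have := (hasFDerivAt_pi'.1 hM.hasFDerivAt j).fderiv
      simp [pd, this]
    rw [hj]
    fin_cases j
    · change pd i hypTime q = _
      rw [pd_hypTime hq]
      fin_cases i <;> simp [e3, div_eq_mul_inv]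
    · change pd i (fun q => q 1) q = _
      rw [pd_coord]
      fin_cases i <;> simp [e3]
    · change pd i (fun q => q 2) q = _
      rw [pd_coord]
      fin_cases i <;> simp [e3]
  have : pd i (fun q => g (hypMap q)) q = fderiv ℝ g (hypMap q) (fderiv ℝ hypMap q (e3 i)) := by
    have h3 := hc.fderiv
    simp only [Function.comp_def] at h3
    simp [pd, h3]
  rw [this, hv]
  split_ifs <;> simp [pd]

/-- A function of `(s, x)` that vanishes where `|x| > s²`. -/
def Narrow (g : Pt → ℝ) : Prop := ∀ q : Pt, q 0 ^ 4 < q 1 ^ 2 + q 2 ^ 2 → g q = 0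

lemma Narrow.vanishing_pd {g : Pt → ℝ} (hg : Narrow g) (i : Fin 3) : Narrow (pd i g) := by
  intro q hq
  have hopen : IsOpen {q : Pt | q 0 ^ 4 < q 1 ^ 2 + q 2 ^ 2} :=
    isOpen_lt (by fun_prop) (by fun_prop)
  have : g =ᶠ[𝓝 q] fun _ => 0 := by
    filter_upwards [hopen.mem_nhds hq] with p hp using hg p hp
  rw [(pd_congr this i).eq_of_nhds, pd_zero]

lemma rad_hypMap_le {q : Pt} (h : rad (hypMap q) ≤ hypMap q 0 - 1) :
    q 1 ^ 2 + q 2 ^ 2 ≤ q 0 ^ 4 := by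
  have h0 : hypMap q 0 = hypTime q := rfl
  have hr : rad (hypMap q) ^ 2 = q 1 ^ 2 + q 2 ^ 2 := by
    simp only [rad]
    rw [Real.sq_sqrt (by positivity)]
    rfl
  have hr0 : 0 ≤ rad (hypMap q) := Real.sqrt_nonneg _
  have ht := hypTime_sq q
  rw [h0] at h
  generalize rad (hypMap q) = r at *
  generalize hypTime q = t at *
  have h1 : r ≤ q 0 ^ 2 := by nlinarith
  nlinarith [sq_nonneg (q 0)]

lemma eventually_eq_zero {u : Pt → ℝ} (hu : Function.support u ⊆ Cone) {p : Pt}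
    (hp : p 0 < 2 ∨ p 0 - 1 < rad p) : u =ᶠ[𝓝 p] fun _ => 0 := by
  have hopen : IsOpen {p : Pt | p 0 < 2 ∨ p 0 - 1 < rad p} := by
    have hr : Continuous rad := by unfold rad; fun_prop
    have h0 : Continuous fun p : Pt => p 0 := continuous_apply 0
    exact (isOpen_lt h0 continuous_const).union (isOpen_lt (h0.sub continuous_const) hr)
  filter_upwards [hopen.mem_nhds hp] with q hq
  by_contra hne
  obtain ⟨h1, h2⟩ := hu hne
  rcases hq with h | h <;> linarith

lemma narrow_comp_hypMap {g : Pt → ℝ} (hg : ∀ p : Pt, p 0 - 1 < rad p → g p = 0) :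
    Narrow (fun q => g (hypMap q)) := by
  intro q hq
  apply hg
  by_contra! h
  exact absurd (rad_hypMap_le h) (not_le.2 hq)

lemma box_eq_zero {u : Pt → ℝ} (hu : Function.support u ⊆ Cone) {p : Pt}
    (hp : p 0 - 1 < rad p) : box u p = 0 := by
  have h := eventually_eq_zero hu (Or.inr hp)
  have h2 : ∀ i j, pd i (pd j u) p = 0 := by
    intro i j
    rw [(pd_congr (pd_congr h j) i).eq_of_nhds, pd_zero, pd_zero]
  simp [box, h2]

lemma contDiff_comp_hypMap {u : Pt → ℝ} (hu : ContDiff ℝ (⊤ : ℕ∞) u)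
    (hs : Function.support u ⊆ Cone) : ContDiff ℝ (⊤ : ℕ∞) (fun q => u (hypMap q)) := by
  refine contDiff_iff_contDiffAt.2 fun q => ?_
  by_cases hq : 0 < hypTime q
  · exact hu.contDiffAt.comp q (contDiffAt_hypMap hq)
  · have h0 : hypMap q 0 < 2 := by
      change hypTime q < 2
      linarith
    have := continuous_hypMap.continuousAt.eventually (eventually_eq_zero hs (Or.inl h0))
    exact (contDiffAt_const (c := (0 : ℝ))).congr_of_eventuallyEq this

lemma box_comp_hypMap {u : Pt → ℝ} (hu : ContDiff ℝ (⊤ : ℕ∞) u) {v : Pt → ℝ}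
    (hv : v = fun q => u (hypMap q)) {q : Pt} (hq : 0 < q 0) :
    q 0 * box u (hypMap q)
      = - q 0 * pd 0 (pd 0 v) q - 2 * (q 1 * pd 1 (pd 0 v) q + q 2 * pd 2 (pd 0 v) q)
        + q 0 * (pd 1 (pd 1 v) q + pd 2 (pd 2 v) q) - 2 * pd 0 v q := by
  have ht : 0 < hypTime q := hypTime_pos hq
  have hnear : ∀ᶠ p in 𝓝 q, 0 < hypTime p :=
    continuous_hypTime.continuousAt.eventually (lt_mem_nhds ht)
  have hu1 : Differentiable ℝ u := hu.differentiable (by simp)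
  have hd : ∀ i, Differentiable ℝ (pd i u) := fun i =>
    (contDiff_pd hu i).differentiable (by simp)
  have hM : DifferentiableAt ℝ hypMap q := (contDiffAt_hypMap ht).differentiableAt (by simp)
  have hc : ∀ i, DifferentiableAt ℝ (fun q => pd i u (hypMap q)) q := fun i =>
    ((hd i) (hypMap q)).comp q hM
  have hi : DifferentiableAt ℝ (fun q => (hypTime q)⁻¹) q :=
    ((contDiffAt_hypTime ht).differentiableAt (by simp)).inv ht.ne'
  have first : ∀ j, pd j v =ᶠ[𝓝 q] fun p => p j * (hypTime p)⁻¹ * pd 0 u (hypMap p)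
      + if j = 0 then 0 else pd j u (hypMap p) := by
    intro j
    filter_upwards [hnear] with p hp
    rw [hv, pd_comp_hypMap hp (hu1 _)]
  have second0 : ∀ i, pd i (pd 0 v) q
      = q 0 * (hypTime q)⁻¹ * pd i (fun p => pd 0 u (hypMap p)) q
        + (q 0 * (- q i / hypTime q ^ 3) + (if 0 = i then 1 else 0) * (hypTime q)⁻¹)
          * pd 0 u (hypMap q) := by
    intro i
    rw [(pd_congr (first 0) i).eq_of_nhds]
    simp only [if_true, add_zero]
    rw [pd_mul i (by fun_prop) (hc 0), pd_mul i (by fun_prop) hi, pd_coord,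
      pd_inv_hypTime ht]
  have second : ∀ j, j ≠ 0 → pd j (pd j v) q
      = q j * (hypTime q)⁻¹ * pd j (fun p => pd 0 u (hypMap p)) q
        + (q j * (- q j / hypTime q ^ 3) + (hypTime q)⁻¹) * pd 0 u (hypMap q)
        + pd j (fun p => pd j u (hypMap p)) q := by
    intro j hj
    rw [(pd_congr (first j) j).eq_of_nhds]
    simp only [hj, if_false]
    rw [pd_add j (by fun_prop) (hc j), pd_mul j (by fun_prop) (hc 0),
      pd_mul j (by fun_prop) hi, pd_coord, pd_inv_hypTime ht]
    simp
  have f0 : pd 0 v q = q 0 * (hypTime q)⁻¹ * pd 0 u (hypMap q) := by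
    simpa using (first 0).eq_of_nhds
  rw [second0, second0, second0, second 1 (by decide), second 2 (by decide), f0]
  simp only [pd_comp_hypMap ht (hd _ _)]
  simp only [box, pd_comm hu 1 0, pd_comm hu 2 0]
  have hsq := hypTime_sq q
  have hne := ht.ne'
  have hs := hq.ne'
  simp
  generalize pd 0 (pd 0 u) (hypMap q) = A at *
  generalize pd 0 u (hypMap q) = B at *
  field_simp
  linear_combination (B - hypTime q * A) * hsq

/-- The conformal multiplier `K₀u + u` in hyperboloidal coordinates. -/
def confMult (v : Pt → ℝ) (q : Pt) : ℝ :=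
  q 0 * pd 0 v q + 2 * (q 1 * pd 1 v q + q 2 * pd 2 v q) + v q

/-- The conformal energy density in hyperboloidal coordinates. -/
def confDensity (v : Pt → ℝ) (q : Pt) : ℝ :=
  confMult v q ^ 2 + q 0 ^ 2 * (pd 1 v q ^ 2 + pd 2 v q ^ 2)

/-- The spatial flux in the conformal energy identity. -/
def confFlux (v : Pt → ℝ) (i : Fin 3) (q : Pt) : ℝ :=
  2 * (q 0 * (confMult v q * pd i v q - q i * (pd 1 v q ^ 2 + pd 2 v q ^ 2)))

lemma contDiff_confMult {v : Pt → ℝ} (hv : ContDiff ℝ (⊤ : ℕ∞) v) :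
    ContDiff ℝ (⊤ : ℕ∞) (confMult v) := by
  have := contDiff_pd hv
  unfold confMult
  fun_prop

lemma contDiff_confDensity {v : Pt → ℝ} (hv : ContDiff ℝ (⊤ : ℕ∞) v) :
    ContDiff ℝ (⊤ : ℕ∞) (confDensity v) := by
  have := contDiff_pd hv
  have := contDiff_confMult hv
  unfold confDensity
  fun_prop

lemma contDiff_confFlux {v : Pt → ℝ} (hv : ContDiff ℝ (⊤ : ℕ∞) v) (i : Fin 3) :
    ContDiff ℝ (⊤ : ℕ∞) (confFlux v i) := by
  have := contDiff_pd hv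
  have := contDiff_confMult hv
  unfold confFlux
  fun_prop

lemma Narrow.vanishing_confMult {v : Pt → ℝ} (hv : Narrow v) : Narrow (confMult v) := by
  intro q hq
  simp [confMult, hv q hq, hv.vanishing_pd _ q hq]

lemma Narrow.vanishing_confDensity {v : Pt → ℝ} (hv : Narrow v) : Narrow (confDensity v) := by
  intro q hq
  simp [confDensity, hv.vanishing_confMult q hq, hv.vanishing_pd _ q hq]

lemma Narrow.vanishing_confFlux {v : Pt → ℝ} (hv : Narrow v) (i : Fin 3) : Narrow (confFlux v i) := by
  intro q hq
  simp [confFlux, hv.vanishing_confMult q hq, hv.vanishing_pd _ q hq]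

lemma conformal_identity {u : Pt → ℝ} (hu : ContDiff ℝ (⊤ : ℕ∞) u) {v : Pt → ℝ}
    (hv : v = fun q => u (hypMap q)) (hvs : ContDiff ℝ (⊤ : ℕ∞) v) {q : Pt} (hq : 0 < q 0) :
    pd 0 (confDensity v) q = pd 1 (confFlux v 1) q + pd 2 (confFlux v 2) q
      - 2 * q 0 * (confMult v q * box u (hypMap q)) := by
  have hb := box_comp_hypMap hu hv hq
  have h0 : Differentiable ℝ v := hvs.differentiable (by simp)
  have hd : ∀ i, Differentiable ℝ (pd i v) := fun i =>
    (contDiff_pd hvs i).differentiable (by simp)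
  have hW : Differentiable ℝ (confMult v) := (contDiff_confMult hvs).differentiable (by simp)
  have dW : ∀ i, pd i (confMult v) q = q 0 * pd i (pd 0 v) q + pd i (fun q => q 0) q * pd 0 v q
      + 2 * (q 1 * pd i (pd 1 v) q + pd i (fun q => q 1) q * pd 1 v q
        + (q 2 * pd i (pd 2 v) q + pd i (fun q => q 2) q * pd 2 v q)) + pd i v q := by
    intro i
    unfold confMult
    simp (disch := fun_prop) only [pd_add, pd_mul, pd_const]
    ring
  have dD : pd 0 (confDensity v) q = 2 * confMult v q * pd 0 (confMult v) q
      + 2 * q 0 * (pd 1 v q ^ 2 + pd 2 v q ^ 2)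
      + q 0 ^ 2 * (2 * pd 1 v q * pd 0 (pd 1 v) q + 2 * pd 2 v q * pd 0 (pd 2 v) q) := by
    unfold confDensity
    simp (disch := fun_prop) only [pd_add, pd_mul, pd_pow, pd_coord]
    simp
    ring
  have dF : ∀ i, i ≠ 0 → pd i (confFlux v i) q = 2 * q 0 * (confMult v q * pd i (pd i v) q
      + pd i (confMult v) q * pd i v q - (pd 1 v q ^ 2 + pd 2 v q ^ 2)
      - q i * (2 * pd 1 v q * pd i (pd 1 v) q + 2 * pd 2 v q * pd i (pd 2 v) q)) := by
    intro i hi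
    unfold confFlux
    simp (disch := fun_prop) only [pd_add, pd_sub, pd_mul, pd_pow, pd_coord, pd_const]
    simp [hi.symm]
    ring
  rw [dD, dF 1 (by decide), dF 2 (by decide), dW, dW, dW]
  simp only [pd_coord, pd_comm hvs 0 1, pd_comm hvs 0 2, pd_comm hvs 2 1]
  simp
  linear_combination (2 * confMult v q) * hb

lemma continuous_slicePt : Continuous fun z : ℝ × (Fin 2 → ℝ) => slicePt z.1 z.2 := by
  refine continuous_pi fun i => ?_
  fin_cases i
  · exact continuous_fst
  · exact (continuous_apply (0 : Fin 2)).comp continuous_snd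
  · exact (continuous_apply (1 : Fin 2)).comp continuous_snd

lemma continuous_slicePt_right (s : ℝ) : Continuous (slicePt s) :=
  continuous_slicePt.comp (Continuous.prodMk_right s)

lemma Narrow.slicePt_eq_zero {g : Pt → ℝ} (hg : Narrow g) {R s : ℝ} (hs : |s| ≤ R)
    {x : Fin 2 → ℝ} (hx : x ∉ Metric.closedBall 0 (R ^ 2)) : g (slicePt s x) = 0 := by
  apply hg
  simp only [Metric.mem_closedBall, dist_zero_right, not_le] at hx
  have hR : 0 ≤ R := (abs_nonneg s).trans hs
  have h4 : s ^ 4 ≤ (R ^ 2) ^ 2 := by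
    have := pow_le_pow_left₀ (abs_nonneg s) hs 4
    rw [← pow_mul]
    rwa [Even.pow_abs (by decide)] at this
  have hsup : ‖x‖ ^ 2 ≤ x 0 ^ 2 + x 1 ^ 2 := by
    have : ‖x‖ ≤ Real.sqrt (x 0 ^ 2 + x 1 ^ 2) := by
      refine (pi_norm_le_iff_of_nonneg (Real.sqrt_nonneg _)).2 fun i => ?_
      refine Real.le_sqrt_of_sq_le ?_
      fin_cases i <;> simp <;> positivity
    calc ‖x‖ ^ 2 ≤ (Real.sqrt (x 0 ^ 2 + x 1 ^ 2)) ^ 2 := by gcongr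
      _ = _ := Real.sq_sqrt (by positivity)
  change s ^ 4 < x 0 ^ 2 + x 1 ^ 2
  have : (R ^ 2) ^ 2 < ‖x‖ ^ 2 := by gcongr
  linarith

lemma Narrow.integrable_slice {g : Pt → ℝ} (hg : Narrow g) (hc : Continuous g) (s : ℝ) :
    Integrable fun x : Fin 2 → ℝ => g (slicePt s x) :=
  (hc.comp (continuous_slicePt_right s)).integrable_of_hasCompactSupport
    (HasCompactSupport.intro (isCompact_closedBall 0 (|s| ^ 2)) fun _ hx =>
      hg.slicePt_eq_zero le_rfl hx)

lemma Narrow.continuous_integral {g : Pt → ℝ} (hg : Narrow g) (hc : Continuous g) :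
    Continuous fun s : ℝ => ∫ x : Fin 2 → ℝ, g (slicePt s x) := by
  refine continuous_iff_continuousAt.2 fun s => ?_
  have hon : ContinuousOn (fun s : ℝ => ∫ x : Fin 2 → ℝ, g (slicePt s x))
      (Metric.ball 0 (|s| + 1)) := by
    refine continuousOn_integral_of_compact_support
      (isCompact_closedBall 0 ((|s| + 1) ^ 2)) ?_ ?_
    · exact (hc.comp continuous_slicePt).continuousOn
    · intro p x hp hx
      have : |p| ≤ |s| + 1 := by simpa using (Metric.mem_ball.1 hp).le
      exact hg.slicePt_eq_zero this hx
  exact hon.continuousAt (Metric.isOpen_ball.mem_nhds (by simp))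

lemma hasDerivAt_slicePt {g : Pt → ℝ} (hd : Differentiable ℝ g) (s : ℝ) (x : Fin 2 → ℝ) :
    HasDerivAt (fun s => g (slicePt s x)) (pd 0 g (slicePt s x)) s := by
  have h := hasDerivAt_line (p := slicePt s x) 0 hd.differentiableAt
  have h2 : HasDerivAt (fun r : ℝ => r - s) 1 s := (hasDerivAt_id s).sub_const s
  have h3 := HasDerivAt.comp s (by simpa using h) h2
  have heq : (fun t : ℝ => g (slicePt s x + t • e3 0)) ∘ (fun r : ℝ => r - s)
      = fun s => g (slicePt s x) := by
    ext r
    simp only [Function.comp_apply]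
    congr 1
    ext i
    fin_cases i <;> simp [slicePt, e3]
  rw [heq] at h3
  simpa using h3

lemma Narrow.hasDerivAt_integral {g : Pt → ℝ} (hg : Narrow g) (hc : ContDiff ℝ (⊤ : ℕ∞) g)
    (s : ℝ) :
    HasDerivAt (fun s : ℝ => ∫ x : Fin 2 → ℝ, g (slicePt s x))
      (∫ x : Fin 2 → ℝ, pd 0 g (slicePt s x)) s := by
  have hp : Continuous (pd 0 g) := (contDiff_pd hc 0).continuous
  set B : Set (Fin 2 → ℝ) := Metric.closedBall 0 ((|s| + 1) ^ 2)
  have hB : IsCompact B := isCompact_closedBall _ _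
  obtain ⟨M, hM⟩ := ((isCompact_closedBall (0 : ℝ) (|s| + 1)).prod hB).exists_bound_of_continuousOn
    (hp.comp continuous_slicePt).continuousOn
  have hint : Integrable (B.indicator fun _ => M) :=
    (integrable_indicator_iff hB.measurableSet).2 (integrableOn_const hB.measure_ne_top)
  refine (hasDerivAt_integral_of_dominated_loc_of_deriv_le
    (F := fun s x => g (slicePt s x)) (F' := fun s x => pd 0 g (slicePt s x))
    (s := Metric.ball 0 (|s| + 1)) (Metric.isOpen_ball.mem_nhds (by simp))
    (Eventually.of_forall fun r =>
      (hc.continuous.comp (continuous_slicePt_right r)).aestronglyMeasurable)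
    (hg.integrable_slice hc.continuous s)
    (hp.comp (continuous_slicePt_right s)).aestronglyMeasurable
    (Eventually.of_forall fun x r hr => ?_) hint
    (Eventually.of_forall fun x r _ => hasDerivAt_slicePt (hc.differentiable (by simp)) r x)).2
  have hr' : |r| ≤ |s| + 1 := by simpa using (Metric.mem_ball.1 hr).le
  by_cases hx : x ∈ B
  · rw [Set.indicator_of_mem hx]
    exact hM (r, x) ⟨Metric.ball_subset_closedBall hr, hx⟩
  · rw [Set.indicator_of_notMem hx, (hg.vanishing_pd 0).slicePt_eq_zero hr' hx, norm_zero]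

lemma Narrow.integral_pd_succ {g : Pt → ℝ} (hg : Narrow g) (hc : ContDiff ℝ (⊤ : ℕ∞) g)
    (a : Fin 2) (s : ℝ) :
    ∫ x : Fin 2 → ℝ, pd a.succ g (slicePt s x) = 0 := by
  have hline : ∀ x : Fin 2 → ℝ, HasLineDerivAt ℝ (fun x => g (slicePt s x))
      (pd a.succ g (slicePt s x)) x (Pi.single a 1) := by
    intro x
    have h := hasDerivAt_line (p := slicePt s x) a.succ
      (hc.differentiable (by simp)).differentiableAt
    have heq : ∀ t : ℝ, slicePt s (x + t • Pi.single a 1) = slicePt s x + t • e3 a.succ := by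
      intro t
      ext i
      fin_cases a <;> fin_cases i <;> simp [slicePt, e3]
    simpa only [HasLineDerivAt, heq] using h
  have h := integral_bilinear_hasLineDerivAt_right_eq_neg_left_of_integrable (μ := volume)
    (f := fun _ : Fin 2 → ℝ => (1 : ℝ)) (f' := fun _ => 0)
    (g := fun x => g (slicePt s x)) (g' := fun x => pd a.succ g (slicePt s x))
    (v := Pi.single a 1) (B := ContinuousLinearMap.mul ℝ ℝ)
    (by simp) (by simpa using (hg.vanishing_pd _).integrable_slice (contDiff_pd hc _).continuous s)
    (by simpa using hg.integrable_slice hc.continuous s)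
    (fun x _ => hasDerivAt_const _ _) (fun x _ => hline x)
  simpa using h

lemma abs_integral_mul_le_sqrt {f g : (Fin 2 → ℝ) → ℝ} (hf : Integrable fun x => f x ^ 2)
    (hg : Integrable fun x => g x ^ 2) (hfg : Integrable fun x => f x * g x) :
    |∫ x, f x * g x| ≤ Real.sqrt (∫ x, f x ^ 2) * Real.sqrt (∫ x, g x ^ 2) := by
  have hF : 0 ≤ ∫ x, f x ^ 2 := integral_nonneg fun x => sq_nonneg _
  have h : ∀ r : ℝ, 0 ≤ (∫ x, f x ^ 2) * (r * r) + (2 * ∫ x, f x * g x) * r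
      + ∫ x, g x ^ 2 := by
    intro r
    have h0 : 0 ≤ ∫ x, (r * f x + g x) ^ 2 := integral_nonneg fun x => sq_nonneg _
    have h1 : ∀ x, (r * f x + g x) ^ 2
        = (r * r) * f x ^ 2 + (2 * r) * (f x * g x) + g x ^ 2 := fun x => by ring
    simp only [h1] at h0
    have h2 : Integrable fun x => (r * r) * f x ^ 2 + (2 * r) * (f x * g x) :=
      (hf.const_mul _).add (hfg.const_mul _)
    rw [integral_add h2 hg, integral_add (hf.const_mul _) (hfg.const_mul _),
      integral_const_mul, integral_const_mul] at h0
    linarith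
  have hd := discrim_le_zero h
  rw [← Real.sqrt_mul hF]
  refine Real.abs_le_sqrt ?_
  unfold discrim at hd
  linarith

lemma sVar_hypMap_sq (q : Pt) : sVar (hypMap q) ^ 2 = q 0 ^ 2 := by
  have h : hypMap q 0 ^ 2 - hypMap q 1 ^ 2 - hypMap q 2 ^ 2 = q 0 ^ 2 := by
    change hypTime q ^ 2 - q 1 ^ 2 - q 2 ^ 2 = _
    rw [hypTime_sq]; ring
  unfold sVar
  rw [h, Real.sq_sqrt (sq_nonneg _)]

lemma Econ_eq {u : Pt → ℝ} (hu : Differentiable ℝ u) {s : ℝ} (hs : 0 < s) :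
    Econ u s = ∫ x : Fin 2 → ℝ, confDensity (fun q => u (hypMap q)) (slicePt s x) := by
  unfold Econ
  congr 1 with x
  have ht : 0 < hypTime (slicePt s x) := hypTime_pos hs
  have hs2 := sVar_hypMap_sq (slicePt s x)
  simp only [hypPt_eq, K0op, confDensity, confMult, pd_comp_hypMap ht (hu _), hs2, dund,
    Fin.sum_univ_two]
  have h0 : hypMap (slicePt s x) 0 = hypTime (slicePt s x) := rfl
  have h1 : hypMap (slicePt s x) 1 = x 0 := rfl
  have h2 : hypMap (slicePt s x) 2 = x 1 := rfl
  have k0 : slicePt s x 0 = s := rfl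
  have k1 : slicePt s x 1 = x 0 := rfl
  have k2 : slicePt s x 2 = x 1 := rfl
  simp only [Fin.succ_zero_eq_one, Fin.succ_one_eq_two, h0, h1, h2, k0, k1, k2]
  simp
  ring

lemma sqrt_le_add_integral {E D N : ℝ → ℝ} (hE : ∀ s, 0 ≤ E s)
    {a b : ℝ} (hab : a ≤ b) (hD : ∀ s ∈ Set.Icc a b, HasDerivAt E (D s) s) (hN : Continuous N)
    (hle : ∀ s ∈ Set.Icc a b, D s ≤ 2 * Real.sqrt (E s) * N s) (hN0 : ∀ s ∈ Set.Icc a b, 0 ≤ N s) :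
    Real.sqrt (E b) ≤ Real.sqrt (E a) + ∫ τ in a..b, N τ := by
  have key : ∀ ε > 0, Real.sqrt (E b + ε) ≤ Real.sqrt (E a + ε) + ∫ τ in a..b, N τ := by
    intro ε hε
    have hpos : ∀ s, 0 < E s + ε := fun s => by linarith [hE s]
    have hder : ∀ s ∈ Set.Icc a b, HasDerivAt (fun s => Real.sqrt (E s + ε))
        (D s / (2 * Real.sqrt (E s + ε))) s :=
      fun s hs => ((hD s hs).add_const ε).sqrt (hpos s).ne'
    have := intervalIntegral.sub_le_integral_of_hasDeriv_right_of_le hab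
      (fun s hs => (hder s hs).continuousAt.continuousWithinAt)
      (fun s hs => (hder s (Set.Ioo_subset_Icc_self hs)).hasDerivWithinAt)
      (hN.continuousOn.integrableOn_Icc) (fun s hs => ?_)
    · linarith
    · have hs' := Set.Ioo_subset_Icc_self hs
      have hsq := Real.sqrt_pos.2 (hpos s)
      rw [div_le_iff₀ (by positivity)]
      have hmono : Real.sqrt (E s) ≤ Real.sqrt (E s + ε) := Real.sqrt_le_sqrt (by linarith)
      have := mul_le_mul_of_nonneg_right hmono (hN0 s hs')
      linarith [hle s hs']
  have hlim : ∀ c : ℝ, Tendsto (fun ε : ℝ => Real.sqrt (c + ε)) (𝓝[>] 0) (𝓝 (Real.sqrt c)) := by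
    intro c
    have : Continuous fun ε : ℝ => Real.sqrt (c + ε) := by fun_prop
    simpa using (this.tendsto 0).mono_left nhdsWithin_le_nhds
  exact le_of_tendsto_of_tendsto (hlim _) ((hlim _).add_const _)
    (eventually_mem_nhdsWithin.mono fun ε hε => key ε hε)

/-- conformal energy estimate on hyperboloids. -/
theorem conformal_energy_estimate :
    ∃ C > (0:ℝ), ∀ u : Pt → ℝ,
      ContDiff ℝ (⊤ : ℕ∞) u → Function.support u ⊆ Cone →
      ∀ s : ℝ, 2 ≤ s →
        Real.sqrt (Econ u s) ≤
          C * (Real.sqrt (Econ u 2)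
            + ∫ τ in (2:ℝ)..s, τ * L2H (box u) τ) := by
  refine ⟨1, one_pos, fun u hu hsupp s hs => ?_⟩
  rw [one_mul]
  obtain ⟨v, hv⟩ : ∃ v : Pt → ℝ, v = fun q => u (hypMap q) := ⟨_, rfl⟩
  have hvs : ContDiff ℝ (⊤ : ℕ∞) v := hv ▸ contDiff_comp_hypMap hu hsupp
  have hvn : Narrow v := by
    rw [hv]
    exact narrow_comp_hypMap fun p hp => (eventually_eq_zero hsupp (Or.inr hp)).eq_of_nhds
  have hbox : Continuous (box u) := by
    have h2 := fun i => (contDiff_pd (contDiff_pd hu i) i).continuous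
    exact ((h2 0).neg.add (h2 1)).add (h2 2)
  have hb : Continuous fun q => box u (hypMap q) := hbox.comp continuous_hypMap
  have hbn : Narrow fun q => box u (hypMap q) := narrow_comp_hypMap fun p => box_eq_zero hsupp
  have hW := contDiff_confMult hvs
  have hWn := hvn.vanishing_confMult
  have hG := contDiff_confDensity hvs
  have hF := contDiff_confFlux hvs
  have hb2n : Narrow fun q => box u (hypMap q) ^ 2 := fun q hq => by simp [hbn q hq]
  have hL : ∀ τ, L2H (box u) τ = Real.sqrt (∫ x, box u (hypMap (slicePt τ x)) ^ 2) := by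
    intro τ
    simp only [L2H, hypPt_eq, Real.sqrt_eq_rpow]
  have hE : ∀ τ, 0 < τ → Econ u τ = ∫ x, confDensity v (slicePt τ x) := by
    intro τ hτ
    rw [Econ_eq (hu.differentiable (by simp)) hτ, hv]
  rw [hE s (by linarith), hE 2 two_pos]
  simp only [hL]
  refine sqrt_le_add_integral (E := fun s => ∫ x, confDensity v (slicePt s x))
    (fun τ => integral_nonneg fun x => by simp only [confDensity, Pi.zero_apply]; positivity) hs
    (fun τ _ => hvn.vanishing_confDensity.hasDerivAt_integral hG τ)
    (continuous_id.mul (hb2n.continuous_integral (hb.pow 2)).sqrt)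
    (fun τ hτ => ?_) (fun τ hτ => mul_nonneg (zero_le_two.trans hτ.1) (Real.sqrt_nonneg _))
  have hτ0 : 0 < τ := by linarith [hτ.1]
  have hWb : Narrow fun q => confMult v q * box u (hypMap q) := fun q hq => by simp [hbn q hq]
  have hW2 : Narrow fun q => confMult v q ^ 2 := fun q hq => by simp [hWn q hq]
  have iWb := hWb.integrable_slice (hW.continuous.mul hb) τ
  have iW2 := hW2.integrable_slice (hW.continuous.pow 2) τ
  have iF := fun i j => ((hvn.vanishing_confFlux i).vanishing_pd j).integrable_slice
    (contDiff_pd (hF i) j).continuous τ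
  have hD : ∫ x, pd 0 (confDensity v) (slicePt τ x)
      = - (2 * τ) * ∫ x, confMult v (slicePt τ x) * box u (hypMap (slicePt τ x)) := by
    have hid : ∀ x, pd 0 (confDensity v) (slicePt τ x)
        = pd 1 (confFlux v 1) (slicePt τ x) + pd 2 (confFlux v 2) (slicePt τ x)
          - 2 * τ * (confMult v (slicePt τ x) * box u (hypMap (slicePt τ x))) := fun x =>
      conformal_identity hu hv hvs (q := slicePt τ x) hτ0
    simp only [hid]
    have iF12 : Integrable fun x =>
        pd 1 (confFlux v 1) (slicePt τ x) + pd 2 (confFlux v 2) (slicePt τ x) :=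
      (iF 1 1).add (iF 2 2)
    rw [integral_sub iF12 (iWb.const_mul _), integral_add (iF 1 1) (iF 2 2),
      integral_const_mul]
    have h1 := (hvn.vanishing_confFlux 1).integral_pd_succ (hF 1) 0 τ
    have h2 := (hvn.vanishing_confFlux 2).integral_pd_succ (hF 2) 1 τ
    simp only [Fin.succ_zero_eq_one, Fin.succ_one_eq_two] at h1 h2
    rw [h1, h2]
    ring
  have hcs := abs_integral_mul_le_sqrt iW2 (hb2n.integrable_slice (hb.pow 2) τ) iWb
  have hmono : Real.sqrt (∫ x, confMult v (slicePt τ x) ^ 2)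
      ≤ Real.sqrt (∫ x, confDensity v (slicePt τ x)) := by
    refine Real.sqrt_le_sqrt (integral_mono iW2
      (hvn.vanishing_confDensity.integrable_slice hG.continuous τ) fun x => ?_)
    simp only [confDensity]
    have : 0 ≤ slicePt τ x 0 ^ 2 * (pd 1 v (slicePt τ x) ^ 2 + pd 2 v (slicePt τ x) ^ 2) := by
      positivity
    linarith
  rw [hD]
  have h1 := (neg_le_abs _).trans
    (hcs.trans (mul_le_mul_of_nonneg_right hmono (Real.sqrt_nonneg _)))
  have h2 := mul_le_mul_of_nonneg_left h1 (by linarith : 0 ≤ 2 * τ)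
  linarith
end
end

section
/- For any sufficiently smooth function u on ℝ^{1+2} supported in the cone K, and any s ∈ [2,+∞), one has ‖(s/t)u‖_{L²_f(H_s)} ≲ ‖(2/t)u‖_{L²_f(H_2)} + ∫_2^s [E_con(u,τ)]^{1/2}/τ dτ, with an implied constant independent of u and s. -/
open MeasureTheory Real Filter Topology
open scoped ENNReal NNReal

noncomputable section

/-- The squared weighted density `((s/t) u)²` on `H_s`. -/
def weightedDensity (u : Pt → ℝ) (s : ℝ) (x : Fin 2 → ℝ) : ℝ :=
  ((s / hypPt s x 0) * u (hypPt s x)) ^ 2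

/-- The `s`-derivative of `weightedDensity` at fixed `x`. -/
def weightedDensityDeriv (u : Pt → ℝ) (s : ℝ) (x : Fin 2 → ℝ) : ℝ :=
  2 * ((s / hypPt s x 0) * u (hypPt s x)) *
    (((hypPt s x 0 - s * (s / hypPt s x 0)) / (hypPt s x 0) ^ 2) * u (hypPt s x)
      + (s / hypPt s x 0) * ((s / hypPt s x 0) * pd 0 u (hypPt s x)))

/-- The integrand of the conformal energy on `H_s`. -/
def conformalDensity (u : Pt → ℝ) (s : ℝ) (x : Fin 2 → ℝ) : ℝ :=
  (K0op u (hypPt s x) + u (hypPt s x)) ^ 2 + ∑ a : Fin 2, (s * dund a u (hypPt s x)) ^ 2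

lemma hypPt_zero_sq (s : ℝ) (x : Fin 2 → ℝ) :
    hypPt s x 0 ^ 2 = s ^ 2 + x 0 ^ 2 + x 1 ^ 2 :=
  Real.sq_sqrt (by positivity)

lemma hypPt_zero_pos {s : ℝ} (hs : 0 < s) (x : Fin 2 → ℝ) : 0 < hypPt s x 0 :=
  Real.sqrt_pos.2 (by positivity)

lemma le_hypPt_zero (s : ℝ) (x : Fin 2 → ℝ) : s ≤ hypPt s x 0 :=
  Real.le_sqrt_of_sq_le (by nlinarith [sq_nonneg (x 0), sq_nonneg (x 1)])

lemma continuous_hypPt : Continuous fun q : ℝ × (Fin 2 → ℝ) => hypPt q.1 q.2 := by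
  refine continuous_pi fun i => ?_
  fin_cases i <;> simp [hypPt] <;> fun_prop

lemma hasDerivAt_hypPt {s : ℝ} (hs : 0 < s) (x : Fin 2 → ℝ) :
    HasDerivAt (fun σ => hypPt σ x) ((s / hypPt s x 0) • e3 0) s := by
  refine hasDerivAt_pi.2 fun i => ?_
  fin_cases i
  · have h : HasDerivAt (fun σ : ℝ => σ ^ 2 + x 0 ^ 2 + x 1 ^ 2) (2 * s) s := by
      simpa using (((hasDerivAt_id s).pow 2).add_const (x 0 ^ 2)).add_const (x 1 ^ 2)
    have h2 := h.sqrt (by positivity)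
    refine h2.congr_deriv ?_
    simp only [e3, hypPt, Fin.zero_eta, Pi.smul_apply, Pi.single_eq_same, smul_eq_mul, mul_one,
      Matrix.cons_val_zero]
    rw [mul_div_mul_left _ _ two_ne_zero]
  · simpa [hypPt, e3] using hasDerivAt_const s (x 0)
  · simpa [hypPt, e3] using hasDerivAt_const s (x 1)

lemma tsupport_subset_of_support_subset_cone {u : Pt → ℝ} (hu : Function.support u ⊆ Cone) :
    tsupport u ⊆ {p | rad p ≤ p 0 - 1} := by
  refine closure_minimal (fun p hp => (hu hp).2.le) (isClosed_le ?_ (by fun_prop))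
  unfold rad
  fun_prop

lemma hypPt_notMem_tsupport {u : Pt → ℝ} (hu : Function.support u ⊆ Cone) {s S : ℝ}
    (hs : 0 < s) (hsS : s ≤ S) {x : Fin 2 → ℝ}
    (hx : x ∉ Metric.closedBall (0 : Fin 2 → ℝ) (S ^ 2)) : hypPt s x ∉ tsupport u := by
  intro hp
  have h1 := tsupport_subset_of_support_subset_cone hu hp
  have hrad : rad (hypPt s x) = √(x 0 ^ 2 + x 1 ^ 2) := by simp [rad, hypPt]
  simp only [Set.mem_ofPred_eq, hrad] at h1
  have hr2 : √(x 0 ^ 2 + x 1 ^ 2) ^ 2 = x 0 ^ 2 + x 1 ^ 2 := Real.sq_sqrt (by positivity)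
  have ht2 := hypPt_zero_sq s x
  have ht := hypPt_zero_pos hs x
  have hr0 := Real.sqrt_nonneg (x 0 ^ 2 + x 1 ^ 2)
  set r := √(x 0 ^ 2 + x 1 ^ 2)
  have hxr : ‖x‖ ≤ r := by
    refine (pi_norm_le_iff_of_nonneg hr0).2 fun i => ?_
    refine abs_le_of_sq_le_sq ?_ hr0
    fin_cases i
    · simpa [hr2] using sq_nonneg (x 1)
    · simpa [hr2] using sq_nonneg (x 0)
  have hr : S ^ 2 < r := by
    rw [mem_closedBall_zero_iff, not_le] at hx
    exact hx.trans_le hxr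
  nlinarith

lemma pd_eq_zero_of_notMem_tsupport {u : Pt → ℝ} {p : Pt} (hp : p ∉ tsupport u) (i : Fin 3) :
    pd i u p = 0 := by
  have h : fderiv ℝ u p = 0 := by
    by_contra h
    exact hp (support_fderiv_subset ℝ h)
  simp [pd, h]

lemma continuous_pd {u : Pt → ℝ} (hu : ContDiff ℝ (⊤ : ℕ∞) u) (i : Fin 3) :
    Continuous (pd i u) :=
  (hu.continuous_fderiv (by simp)).clm_apply continuous_const

section Densities

variable {u : Pt → ℝ}

lemma weightedDensity_eq_zero {s : ℝ} {x : Fin 2 → ℝ} (h : hypPt s x ∉ tsupport u) :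
    weightedDensity u s x = 0 := by
  simp [weightedDensity, image_eq_zero_of_notMem_tsupport h]

lemma weightedDensityDeriv_eq_zero {s : ℝ} {x : Fin 2 → ℝ} (h : hypPt s x ∉ tsupport u) :
    weightedDensityDeriv u s x = 0 := by
  simp [weightedDensityDeriv, image_eq_zero_of_notMem_tsupport h]

lemma conformalDensity_eq_zero {s : ℝ} {x : Fin 2 → ℝ} (h : hypPt s x ∉ tsupport u) :
    conformalDensity u s x = 0 := by
  simp [conformalDensity, K0op, dund, image_eq_zero_of_notMem_tsupport h,
    pd_eq_zero_of_notMem_tsupport h]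

lemma continuousOn_weightedDensity (hu : ContDiff ℝ (⊤ : ℕ∞) u) :
    ContinuousOn (Function.uncurry (weightedDensity u)) (Set.Ioi 0 ×ˢ Set.univ) := by
  rintro ⟨s, x⟩ ⟨hs, -⟩
  have ht : hypPt s x 0 ≠ 0 := (hypPt_zero_pos hs x).ne'
  have hH := continuous_hypPt
  have hT : Continuous fun q : ℝ × (Fin 2 → ℝ) => hypPt q.1 q.2 0 := (continuous_apply 0).comp hH
  have hU : Continuous fun q : ℝ × (Fin 2 → ℝ) => u (hypPt q.1 q.2) := hu.continuous.comp hH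
  have hd : ContinuousAt (fun q : ℝ × (Fin 2 → ℝ) => q.1 / hypPt q.1 q.2 0) (s, x) :=
    continuousAt_fst.div hT.continuousAt ht
  exact ((hd.mul hU.continuousAt).pow 2).continuousWithinAt

lemma continuousOn_weightedDensityDeriv (hu : ContDiff ℝ (⊤ : ℕ∞) u) :
    ContinuousOn (Function.uncurry (weightedDensityDeriv u)) (Set.Ioi 0 ×ˢ Set.univ) := by
  rintro ⟨s, x⟩ ⟨hs, -⟩
  have ht : hypPt s x 0 ≠ 0 := (hypPt_zero_pos hs x).ne'
  have hH := continuous_hypPt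
  have hT : Continuous fun q : ℝ × (Fin 2 → ℝ) => hypPt q.1 q.2 0 := (continuous_apply 0).comp hH
  have hU : Continuous fun q : ℝ × (Fin 2 → ℝ) => u (hypPt q.1 q.2) := hu.continuous.comp hH
  have hP : Continuous fun q : ℝ × (Fin 2 → ℝ) => pd 0 u (hypPt q.1 q.2) :=
    (continuous_pd hu 0).comp hH
  have hd : ContinuousAt (fun q : ℝ × (Fin 2 → ℝ) => q.1 / hypPt q.1 q.2 0) (s, x) :=
    continuousAt_fst.div hT.continuousAt ht
  have hq : ContinuousAt (fun q : ℝ × (Fin 2 → ℝ) =>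
      (hypPt q.1 q.2 0 - q.1 * (q.1 / hypPt q.1 q.2 0)) / (hypPt q.1 q.2 0) ^ 2) (s, x) :=
    (hT.continuousAt.sub (continuousAt_fst.mul hd)).div (hT.continuousAt.pow 2) (pow_ne_zero 2 ht)
  exact ((continuousAt_const.mul (hd.mul hU.continuousAt)).mul
    ((hq.mul hU.continuousAt).add (hd.mul (hd.mul hP.continuousAt)))).continuousWithinAt

lemma continuousOn_conformalDensity (hu : ContDiff ℝ (⊤ : ℕ∞) u) :
    ContinuousOn (Function.uncurry (conformalDensity u)) (Set.Ioi 0 ×ˢ Set.univ) := by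
  rintro ⟨s, x⟩ ⟨hs, -⟩
  have ht : hypPt s x 0 ≠ 0 := (hypPt_zero_pos hs x).ne'
  have hu0 : ContinuousAt u (hypPt s x) := hu.continuous.continuousAt
  have hp (i : Fin 3) : ContinuousAt (pd i u) (hypPt s x) := (continuous_pd hu i).continuousAt
  have hc (i : Fin 3) : ContinuousAt (fun p : Pt => p i) (hypPt s x) :=
    (continuous_apply i).continuousAt
  have hd (a : Fin 2) : ContinuousAt (dund a u) (hypPt s x) :=
    (((hc a.succ).div (hc 0) ht).mul (hp 0)).add (hp a.succ)
  have hv : ContinuousAt sVar (hypPt s x) := by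
    unfold sVar
    fun_prop
  have hK : ContinuousAt (K0op u) (hypPt s x) :=
    (((hv.pow 2).div (hc 0) ht).mul (hp 0)).add
      (continuousAt_const.mul (tendsto_finsetSum _ fun a _ => (hc a.succ).mul (hd a)))
  have hH : ContinuousAt (fun q : ℝ × (Fin 2 → ℝ) => hypPt q.1 q.2) (s, x) :=
    continuous_hypPt.continuousAt
  have hKu : ContinuousAt (fun q : ℝ × (Fin 2 → ℝ) =>
      K0op u (hypPt q.1 q.2) + u (hypPt q.1 q.2)) (s, x) :=
    ContinuousAt.comp (f := fun q : ℝ × (Fin 2 → ℝ) => hypPt q.1 q.2) (x := (s, x))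
      (hK.add hu0) hH
  have hdH (a : Fin 2) : ContinuousAt (fun q : ℝ × (Fin 2 → ℝ) =>
      dund a u (hypPt q.1 q.2)) (s, x) :=
    ContinuousAt.comp (f := fun q : ℝ × (Fin 2 → ℝ) => hypPt q.1 q.2) (x := (s, x)) (hd a) hH
  exact ((hKu.pow 2).add (tendsto_finsetSum _ fun a _ =>
    (continuousAt_fst.mul (hdH a)).pow 2)).continuousWithinAt

/-- A density that is continuous for `s > 0` and vanishes off the support of `u` is integrable on
every `H_s`. -/
lemma integrable_of_eq_zero_off_tsupport (hsupp : Function.support u ⊆ Cone)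
    {f : ℝ → (Fin 2 → ℝ) → ℝ}
    (hf : ContinuousOn (Function.uncurry f) (Set.Ioi 0 ×ˢ Set.univ))
    (hf0 : ∀ {s : ℝ} {x : Fin 2 → ℝ}, hypPt s x ∉ tsupport u → f s x = 0) {s : ℝ} (hs : 0 < s) :
    Integrable (f s) := by
  have hc : Continuous (f s) :=
    hf.comp_continuous (f := fun x => (s, x)) (by fun_prop) fun x => ⟨hs, trivial⟩
  exact hc.integrable_of_hasCompactSupport <|
    HasCompactSupport.intro (isCompact_closedBall 0 (s ^ 2)) fun x hx =>
      hf0 (hypPt_notMem_tsupport hsupp hs le_rfl hx)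

lemma continuousOn_Econ (hu : ContDiff ℝ (⊤ : ℕ∞) u) (hsupp : Function.support u ⊆ Cone)
    {a b : ℝ} (ha : 0 < a) : ContinuousOn (Econ u) (Set.Icc a b) :=
  continuousOn_integral_of_compact_support (isCompact_closedBall 0 (b ^ 2))
    ((continuousOn_conformalDensity hu).mono
      (Set.prod_mono (fun _ h => ha.trans_le h.1) subset_rfl))
    fun _ _ hs hx => conformalDensity_eq_zero
      (hypPt_notMem_tsupport hsupp (ha.trans_le hs.1) hs.2 hx)

lemma hasDerivAt_weightedDensity (hu : ContDiff ℝ (⊤ : ℕ∞) u) {s : ℝ} (hs : 0 < s)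
    (x : Fin 2 → ℝ) :
    HasDerivAt (fun σ => weightedDensity u σ x) (weightedDensityDeriv u s x) s := by
  have ht : hypPt s x 0 ≠ 0 := (hypPt_zero_pos hs x).ne'
  have hH := hasDerivAt_hypPt hs x
  have hT : HasDerivAt (fun σ => hypPt σ x 0) (s / hypPt s x 0) s := by
    simpa [e3] using hasDerivAt_pi.1 hH 0
  have hU : HasDerivAt (fun σ => u (hypPt σ x)) ((s / hypPt s x 0) * pd 0 u (hypPt s x)) s := by
    have h := ((hu.differentiable (by simp)) (hypPt s x)).hasFDerivAt.comp_hasDerivAt s hH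
    rwa [map_smul, smul_eq_mul] at h
  refine ((((hasDerivAt_id s).div hT ht).mul hU).pow 2).congr_deriv ?_
  simp [weightedDensityDeriv]

lemma hasDerivAt_integral_weightedDensity (hu : ContDiff ℝ (⊤ : ℕ∞) u)
    (hsupp : Function.support u ⊆ Cone) {s : ℝ} (hs : 0 < s) :
    HasDerivAt (fun σ => ∫ x, weightedDensity u σ x) (∫ x, weightedDensityDeriv u s x) s := by
  set k := Metric.closedBall (0 : Fin 2 → ℝ) ((2 * s) ^ 2)
  have hk : IsCompact k := isCompact_closedBall _ _
  have hcd := continuousOn_weightedDensityDeriv hu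
  have hI : Set.Icc (s / 2) (2 * s) ⊆ Set.Ioi 0 := fun σ h => (half_pos hs).trans_le h.1
  obtain ⟨M, hM⟩ := (isCompact_Icc.prod hk).exists_bound_of_continuousOn
    (hcd.mono (Set.prod_mono hI (Set.subset_univ k)))
  have hint {σ : ℝ} (h : 0 < σ) := integrable_of_eq_zero_off_tsupport hsupp
    (continuousOn_weightedDensity hu) weightedDensity_eq_zero h
  have hnhds : Set.Icc (s / 2) (2 * s) ∈ 𝓝 s := Icc_mem_nhds (by linarith) (by linarith)
  refine (hasDerivAt_integral_of_dominated_loc_of_deriv_le (bound := k.indicator fun _ => M)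
    hnhds ?_ (hint hs) ?_ ?_ ?_ ?_).2
  · filter_upwards [hnhds] with σ hσ using (hint (hI hσ)).aestronglyMeasurable
  · exact (integrable_of_eq_zero_off_tsupport hsupp hcd
      weightedDensityDeriv_eq_zero hs).aestronglyMeasurable
  · refine ae_of_all _ fun x σ hσ => ?_
    by_cases hx : x ∈ k
    · simpa [hx] using hM (σ, x) ⟨hσ, hx⟩
    · simp [hx, weightedDensityDeriv_eq_zero (hypPt_notMem_tsupport hsupp (hI hσ) hσ.2 hx)]
  · exact (integrable_indicator_iff hk.measurableSet).2
      (integrableOn_const hk.measure_lt_top.ne)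
  · exact ae_of_all _ fun x σ hσ => hasDerivAt_weightedDensity hu (hI hσ) x

lemma weightedDensityDeriv_le {s l : ℝ} (hs : 0 < s) (hl : 0 < l) (x : Fin 2 → ℝ) :
    weightedDensityDeriv u s x ≤
      3 / s * (l * weightedDensity u s x + l⁻¹ * conformalDensity u s x) := by
  have ht := hypPt_zero_pos hs x
  have ht2 := hypPt_zero_sq s x
  have hst := le_hypPt_zero s x
  have hx0 : hypPt s x 1 = x 0 := rfl
  have hx1 : hypPt s x 2 = x 1 := rfl
  have hv : sVar (hypPt s x) ^ 2 = s ^ 2 := by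
    have : hypPt s x 0 ^ 2 - hypPt s x 1 ^ 2 - hypPt s x 2 ^ 2 = s ^ 2 := by
      rw [hx0, hx1]; linarith
    rw [sVar, this, Real.sqrt_sq hs.le]
  have hA : K0op u (hypPt s x) = s ^ 2 / hypPt s x 0 * pd 0 u (hypPt s x)
      + 2 * (x 0 * dund 0 u (hypPt s x) + x 1 * dund 1 u (hypPt s x)) := by
    simp [K0op, hv, Fin.sum_univ_two, hx0, hx1]
  simp only [weightedDensityDeriv, weightedDensity, conformalDensity, Fin.sum_univ_two]
  set A := K0op u (hypPt s x) + u (hypPt s x) with hAdef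
  generalize dund 0 u (hypPt s x) = d0 at *
  generalize dund 1 u (hypPt s x) = d1 at *
  generalize pd 0 u (hypPt s x) = q at *
  generalize u (hypPt s x) = v at *
  generalize hypPt s x 0 = t at *
  set w := s / t * v with hw
  set g := (s * A - 2 * (x 0 * (s * d0) + x 1 * (s * d1))) / t with hg
  have hD : 2 * w * ((t - s * (s / t)) / t ^ 2 * v + s / t * (s / t * q))
      = 2 / s * (w * g) - 2 * (s / t ^ 2) * w ^ 2 := by
    rw [hg, hw, hAdef, hA]
    field_simp
    ring
  have hg2 : g ^ 2 ≤ 9 * (A ^ 2 + ((s * d0) ^ 2 + (s * d1) ^ 2)) := by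
    rw [hg, div_pow, div_le_iff₀ (by positivity)]
    generalize s * d0 = y at *
    generalize s * d1 = z at *
    nlinarith [sq_nonneg (s * y + 2 * x 0 * A), sq_nonneg (s * z + 2 * x 1 * A),
      sq_nonneg (x 0 * z - x 1 * y), mul_nonneg (sq_nonneg s) (sq_nonneg A),
      mul_nonneg (sq_nonneg s) (add_nonneg (sq_nonneg y) (sq_nonneg z)),
      mul_nonneg (add_nonneg (sq_nonneg (x 0)) (sq_nonneg (x 1)))
        (add_nonneg (sq_nonneg A) (add_nonneg (sq_nonneg y) (sq_nonneg z)))]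
  have hneg : 0 ≤ 2 * (s / t ^ 2) * w ^ 2 := by positivity
  have hyoung : 2 * (w * g) ≤ 3 * (l * w ^ 2 + l⁻¹ * (A ^ 2 + ((s * d0) ^ 2 + (s * d1) ^ 2))) := by
    have h1 : 0 ≤ (3 * l * w - g) ^ 2 / (3 * l) := by positivity
    have h2 : (3 * l * w - g) ^ 2 / (3 * l) = 3 * (l * w ^ 2) - 2 * (w * g) + l⁻¹ * g ^ 2 / 3 := by
      field_simp
      ring
    have h3 := mul_le_mul_of_nonneg_left hg2 (inv_pos.2 hl).le
    linarith
  rw [hD]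
  calc _ ≤ 1 / s * (2 * (w * g)) := by
        rw [← sub_nonneg]; convert hneg using 1; ring
    _ ≤ 1 / s * _ := mul_le_mul_of_nonneg_left hyoung (by positivity)
    _ = _ := by ring

lemma integral_weightedDensityDeriv_le (hu : ContDiff ℝ (⊤ : ℕ∞) u)
    (hsupp : Function.support u ⊆ Cone) {s l : ℝ} (hs : 0 < s) (hl : 0 < l) :
    ∫ x, weightedDensityDeriv u s x ≤
      3 / s * (l * (∫ x, weightedDensity u s x) + l⁻¹ * Econ u s) := by
  have hw := integrable_of_eq_zero_off_tsupport hsupp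
    (continuousOn_weightedDensity hu) weightedDensity_eq_zero hs
  have hd := integrable_of_eq_zero_off_tsupport hsupp
    (continuousOn_weightedDensityDeriv hu) weightedDensityDeriv_eq_zero hs
  have he := integrable_of_eq_zero_off_tsupport hsupp
    (continuousOn_conformalDensity hu) conformalDensity_eq_zero hs
  calc _ ≤ ∫ x, 3 / s * (l * weightedDensity u s x + l⁻¹ * conformalDensity u s x) :=
        integral_mono hd (((hw.const_mul l).add (he.const_mul l⁻¹)).const_mul _)
          fun x => weightedDensityDeriv_le hs hl x
    _ = _ := by
        rw [integral_const_mul, integral_add (hw.const_mul l) (he.const_mul l⁻¹),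
          integral_const_mul, integral_const_mul]
        rfl

lemma deriv_sqrt_integral_weightedDensity_le (hu : ContDiff ℝ (⊤ : ℕ∞) u)
    (hsupp : Function.support u ⊆ Cone) {s ε : ℝ} (hs : 0 < s) (hε : 0 < ε) :
    (∫ x, weightedDensityDeriv u s x) / (2 * √((∫ x, weightedDensity u s x) + ε)) ≤
      3 * (√(Econ u s) / s) := by
  have hF : 0 ≤ ∫ x, weightedDensity u s x := integral_nonneg fun x => sq_nonneg _
  have hE : 0 ≤ Econ u s := integral_nonneg fun x => by positivity
  have hbound {l : ℝ} (hl : 0 < l) := integral_weightedDensityDeriv_le hu hsupp hs hl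
  generalize ∫ x, weightedDensity u s x = F at *
  generalize ∫ x, weightedDensityDeriv u s x = D at *
  have hR : 0 < √(F + ε) := Real.sqrt_pos.2 (by linarith)
  have hR2 : √(F + ε) ^ 2 = F + ε := Real.sq_sqrt (by linarith)
  have hE2 : √(Econ u s) ^ 2 = Econ u s := Real.sq_sqrt hE
  have hE0 := Real.sqrt_nonneg (Econ u s)
  set R := √(F + ε)
  set e := √(Econ u s)
  refine le_of_forall_pos_le_add fun δ hδ => ?_
  set η := s * δ / 3 * 2 with hη
  have hη0 : 0 < η := by positivity
  have hlF : (e + η) / R * F ≤ (e + η) * R := by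
    rw [div_mul_eq_mul_div, div_le_iff₀ hR]
    nlinarith
  have hlE : ((e + η) / R)⁻¹ * Econ u s ≤ e * R := by
    rw [inv_div, div_mul_eq_mul_div, div_le_iff₀ (by positivity), ← hE2]
    nlinarith [mul_nonneg (mul_nonneg hE0 hη0.le) hR.le]
  rw [div_le_iff₀ (by positivity)]
  calc D ≤ _ := hbound (l := (e + η) / R) (by positivity)
    _ ≤ 3 / s * ((e + η) * R + e * R) :=
        mul_le_mul_of_nonneg_left (add_le_add hlF hlE) (by positivity)
    _ = (3 * (e / s) + δ) * (2 * R) := by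
        rw [hη]
        field_simp
        ring

lemma sqrt_integral_weightedDensity_le (hu : ContDiff ℝ (⊤ : ℕ∞) u)
    (hsupp : Function.support u ⊆ Cone) {s ε : ℝ} (hs : 2 ≤ s) (hε : 0 < ε) :
    √((∫ x, weightedDensity u s x) + ε) ≤
      √((∫ x, weightedDensity u 2 x) + ε) + 3 * ∫ τ in (2 : ℝ)..s, √(Econ u τ) / τ := by
  have hcont : ContinuousOn (fun τ => √(Econ u τ) / τ) (Set.Icc 1 (s + 1)) :=
    ((continuousOn_Econ hu hsupp one_pos).sqrt).div continuousOn_id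
      fun τ h => (zero_lt_one.trans_le h.1).ne'
  have hint : IntervalIntegrable (fun τ => √(Econ u τ) / τ) volume 2 s :=
    (hcont.mono (by rw [Set.uIcc_of_le hs]; exact Set.Icc_subset_Icc (by norm_num) (by linarith)))
      |>.intervalIntegrable
  have hder {σ : ℝ} (hσ : 0 < σ) :
      HasDerivAt (fun τ => √((∫ x, weightedDensity u τ x) + ε))
        ((∫ x, weightedDensityDeriv u σ x) / (2 * √((∫ x, weightedDensity u σ x) + ε))) σ := by
    have hF : 0 ≤ ∫ x, weightedDensity u σ x := integral_nonneg fun x => sq_nonneg _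
    exact ((hasDerivAt_integral_weightedDensity hu hsupp hσ).add_const ε).sqrt (by linarith)
  have h := intervalIntegral.sub_le_integral_of_hasDeriv_right_of_le hs
    (fun σ hσ => (hder (two_pos.trans_le hσ.1)).continuousAt.continuousWithinAt)
    (fun σ hσ => (hder (two_pos.trans hσ.1)).hasDerivWithinAt)
    (((intervalIntegrable_iff_integrableOn_Icc_of_le hs).1 hint).const_mul 3)
    (fun σ hσ => deriv_sqrt_integral_weightedDensity_le hu hsupp (two_pos.trans hσ.1) hε)
  rw [intervalIntegral.integral_const_mul] at h
  linarith

end Densities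

/-- weighted `L²`-type estimate on hyperboloids via the conformal energy. -/
theorem weighted_L2_estimate :
    ∃ C > (0:ℝ), ∀ u : Pt → ℝ,
      ContDiff ℝ (⊤ : ℕ∞) u → Function.support u ⊆ Cone →
      ∀ s : ℝ, 2 ≤ s →
        L2H (fun p => (s / p 0) * u p) s ≤
          C * (L2H (fun p => (2 / p 0) * u p) 2
            + ∫ τ in (2:ℝ)..s, Real.sqrt (Econ u τ) / τ) := by
  refine ⟨3, by norm_num, fun u hu hsupp s hs => ?_⟩
  have hL (σ : ℝ) : L2H (fun p => (σ / p 0) * u p) σ = √(∫ x, weightedDensity u σ x) :=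
    (Real.sqrt_eq_rpow _).symm
  rw [hL, hL]
  have hlim (F : ℝ) : Tendsto (fun ε => √(F + ε)) (𝓝[>] 0) (𝓝 √F) := by
    have h : Continuous fun ε : ℝ => √(F + ε) := by fun_prop
    simpa using (h.tendsto 0).mono_left nhdsWithin_le_nhds
  have h := le_of_tendsto_of_tendsto (hlim _) ((hlim _).add_const _)
    (eventually_mem_nhdsWithin.mono fun ε hε =>
      sqrt_integral_weightedDensity_le hu hsupp hs hε)
  linarith [Real.sqrt_nonneg (∫ x, weightedDensity u 2 x)]
end
end
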